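/- The additive subgroup of ℤ generated by all products C(2, n₁)·C(2, n₂)⋯C(2, n_m)·2^{(n₁+⋯+n_m)-1}, over all m ≥ 1 and n₁, …, n_m ≥ 1 with n₁ + ⋯ + n_m ≥ 3, equals 8ℤ. Consequently, the quotient of the subgroup corresponding to the condition n₁+⋯+n_m ≥ 2 (which equals 2ℤ) by this subgroup is cyclic of order 4. -/

import Mathlib

theorem stmt_9 :
    AddSubgroup.closure
        {x : ℤ | ∃ (m : ℕ) (_ : 1 ≤ m) (n : Fin m → ℕ),
          (∀ j, 1 ≤ n j) ∧ 3 ≤ ∑ j, n j ∧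
          x = (∏ j, (Nat.choose 2 (n j) : ℤ)) * 2 ^ ((∑ j, n j) - 1)} =
      AddSubgroup.zmultiples (8 : ℤ) ∧
    AddSubgroup.closure
        {x : ℤ | ∃ (m : ℕ) (_ : 1 ≤ m) (n : Fin m → ℕ),
          (∀ j, 1 ≤ n j) ∧ 2 ≤ ∑ j, n j ∧
          x = (∏ j, (Nat.choose 2 (n j) : ℤ)) * 2 ^ ((∑ j, n j) - 1)} =
      AddSubgroup.zmultiples (2 : ℤ) ∧
    IsAddCyclic (AddSubgroup.zmultiples (2 : ℤ) ⧸
        (AddSubgroup.zmultiples (8 : ℤ)).addSubgroupOf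
          (AddSubgroup.zmultiples (2 : ℤ))) ∧
    Nat.card (AddSubgroup.zmultiples (2 : ℤ) ⧸
        (AddSubgroup.zmultiples (8 : ℤ)).addSubgroupOf
          (AddSubgroup.zmultiples (2 : ℤ))) = 4 := by 
  refine ⟨?_, ?_, ?_, ?_⟩
  · apply le_antisymm
    · rw [AddSubgroup.closure_le]
      rintro x ⟨m, _, n, hn, h3, rfl⟩
      rw [SetLike.mem_coe, Int.mem_zmultiples_iff]
      by_cases h4 : 4 ≤ ∑ j, n j
      · apply Dvd.dvd.mul_left
        exact (pow_dvd_pow (2 : ℤ) (show 3 ≤ (∑ j, n j) - 1 by omega))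
      · have hs : ∑ j, n j = 3 := by omega
        have hj : ∃ j, n j ≠ 2 := by
          by_contra! hc
          simp [hc] at hs
          omega
        obtain ⟨j, hj⟩ := hj
        have h2 : (2 : ℤ) ∣ (Nat.choose 2 (n j) : ℤ) := by
          have hle : n j ≤ 3 := hs ▸ Finset.single_le_sum (f := n) (fun _ _ => Nat.zero_le _) (Finset.mem_univ j)
          have h1 : 1 ≤ n j := hn j
          generalize n j = k at *
          interval_cases k <;> simp_all [Nat.choose]
        have hp := h2.trans (Finset.dvd_prod_of_mem (fun j => (Nat.choose 2 (n j) : ℤ)) (Finset.mem_univ j))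
        rw [hs]
        exact mul_dvd_mul hp (show (4 : ℤ) ∣ 2 ^ (3 - 1) by norm_num)
    · rw [AddSubgroup.zmultiples_le]
      apply AddSubgroup.subset_closure
      exact ⟨2, by norm_num, ![1, 2], by decide, by decide, by simp [Fin.sum_univ_two]⟩
  · apply le_antisymm
    · rw [AddSubgroup.closure_le]
      rintro x ⟨m, _, n, _, h2, rfl⟩
      rw [SetLike.mem_coe, Int.mem_zmultiples_iff]
      apply Dvd.dvd.mul_left
      exact dvd_pow_self _ (by omega)
    · rw [AddSubgroup.zmultiples_le]
      apply AddSubgroup.subset_closure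
      exact ⟨1, le_rfl, ![2], by decide, by decide, by simp⟩
  · exact isAddCyclic_of_surjective (QuotientAddGroup.mk' _) (QuotientAddGroup.mk'_surjective _)
  · have h := AddSubgroup.relIndex_mul_index (H := AddSubgroup.zmultiples (8 : ℤ))
      (K := AddSubgroup.zmultiples (2 : ℤ)) (by
        rw [AddSubgroup.zmultiples_le, Int.mem_zmultiples_iff]; norm_num)
    rw [Int.index_zmultiples, Int.index_zmultiples] at h
    change (AddSubgroup.zmultiples (8 : ℤ)).relIndex (AddSubgroup.zmultiples (2 : ℤ)) = 4
    norm_num at h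
    omega
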